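/- Brezis–Pazy/Kobayashi sequential product formula in Hilbert space: Let X be a Hilbert space, ω ∈ ℝ, and let A, B ⊆ X × X be such that A, B and A + B are all ω-m-dissipative and A + B is a closed subset of X × X. Let S, T and U be the strongly continuous semigroups of type ω generated by A, B and A + B respectively, via the Crandall–Liggett formula. Then for every x ∈ X and every t ≥ 0, U(t)x = lim_{n→∞} (S(t/n) ∘ T(t/n))^n x. -/

import Mathlib

open Filter Set

def IsDissipativeSet {X : Type*} [NormedAddCommGroup X] [NormedSpace ℝ X]
    (A : Set (X × X)) : Prop :=
  ∀ α : ℝ, 0 < α → ∀ a ∈ A, ∀ b ∈ A,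
    ‖a.1 - b.1‖ ≤ ‖a.1 - b.1 - α • (a.2 - b.2)‖

def IsMDissipativeSet {X : Type*} [NormedAddCommGroup X] [NormedSpace ℝ X]
    (A : Set (X × X)) : Prop :=
  IsDissipativeSet A ∧ Dense {x : X | ∃ y, (x, y) ∈ A} ∧
    ∀ α : ℝ, 0 < α → ∀ w : X, ∃ a ∈ A, w = a.1 - α • a.2

def opShift {X : Type*} [AddCommGroup X] [Module ℝ X]
    (A : Set (X × X)) (ω : ℝ) : Set (X × X) :=
  {q | ∃ a ∈ A, q = (a.1, a.2 - ω • a.1)}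

/-- Sum of two multivalued operators: `A + B = {(x, y + z) : (x,y) ∈ A, (x,z) ∈ B}`. -/
def opSum {X : Type*} [AddCommGroup X] (A B : Set (X × X)) : Set (X × X) :=
  {q | ∃ y z, (q.1, y) ∈ A ∧ (q.1, z) ∈ B ∧ q.2 = y + z}

/-- `T` is the strongly continuous semigroup of type `ω` generated by `A` via the
Crandall–Liggett exponential formula. -/
def GeneratedBy {X : Type*} [NormedAddCommGroup X] [NormedSpace ℝ X]
    (ω : ℝ) (A : Set (X × X)) (T : ℝ → X → X) : Prop :=
  (∀ x, T 0 x = x) ∧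
  (∀ t, 0 ≤ t → ∀ s, 0 ≤ s → ∀ x, T t (T s x) = T (t + s) x) ∧
  (∀ t, 0 ≤ t → ∀ x y : X, ‖T t x - T t y‖ ≤ Real.exp (ω * t) * ‖x - y‖) ∧
  (∀ x, ContinuousOn (fun t => T t x) (Set.Ici (0:ℝ))) ∧
  (∀ t, 0 ≤ t → ∀ x : X, ∀ J : ℕ → X → X,
    (∀ n : ℕ, 0 < n → t * ω / n < 1 →
      ∀ y, ∃ z, (J n y, z) ∈ A ∧ J n y - (t / n) • z = y) →
    Tendsto (fun n : ℕ => (J n)^[n] x) atTop (nhds (T t x)))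

namespace BP

variable {X : Type*} [NormedAddCommGroup X] [InnerProductSpace ℝ X]

/-- one-sided Lipschitz form of dissipativity -/
def Diss (W : ℝ) (A : Set (X × X)) : Prop :=
  ∀ x y x' y', (x, y) ∈ A → (x', y') ∈ A → inner ℝ (y - y') (x - x') ≤ W * ‖x - x'‖ ^ 2

theorem inner_nonpos_of {d e : X} (h : ∀ α : ℝ, 0 < α → ‖d‖ ≤ ‖d - α • e‖) :
    inner ℝ e d ≤ 0 := by
  by_contra hc
  push Not at hc
  have key : ∀ α : ℝ, 0 < α → 2 * inner ℝ e d ≤ α * ‖e‖ ^ 2 := by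
    intro α hα
    have h1 := h α hα
    have h2 : ‖d‖ ^ 2 ≤ ‖d - α • e‖ ^ 2 := by gcongr
    rw [norm_sub_sq_real, inner_smul_right, norm_smul, Real.norm_eq_abs, abs_of_pos hα,
      real_inner_comm] at h2
    have h3 : α * (2 * inner ℝ e d) ≤ α * (α * ‖e‖ ^ 2) := by nlinarith
    exact le_of_mul_le_mul_left h3 hα
  have h1 := key (inner ℝ e d / (‖e‖ ^ 2 + 1)) (by positivity)
  have h2 : inner ℝ e d / (‖e‖ ^ 2 + 1) * ‖e‖ ^ 2 ≤ inner ℝ e d := by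
    rw [div_mul_eq_mul_div, div_le_iff₀ (by positivity)]
    nlinarith
  linarith

theorem diss_of {A : Set (X × X)} {ω W : ℝ} (hW : |ω| ≤ W)
    (h : IsDissipativeSet (opShift A ω)) : Diss W A := by
  intro x y x' y' hx hx'
  have h1 : inner ℝ ((y - ω • x) - (y' - ω • x')) (x - x') ≤ 0 := by
    apply inner_nonpos_of
    intro α hα
    exact h α hα (x, y - ω • x) ⟨_, hx, rfl⟩ (x', y' - ω • x') ⟨_, hx', rfl⟩
  have h2 : (y - ω • x) - (y' - ω • x') = (y - y') - ω • (x - x') := by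
    rw [smul_sub]; abel
  rw [h2, inner_sub_left, inner_smul_left, real_inner_self_eq_norm_sq] at h1
  simp only [conj_trivial] at h1
  have h3 : ω * ‖x - x'‖ ^ 2 ≤ W * ‖x - x'‖ ^ 2 := by
    gcongr
    exact (le_abs_self _).trans hW
  linarith

theorem range_of {A : Set (X × X)} {ω : ℝ} (h : IsMDissipativeSet (opShift A ω))
    {l : ℝ} (hl : 0 < l) (hlω : l * ω < 1) (w : X) :
    ∃ u c, (u, c) ∈ A ∧ u - l • c = w := by
  have hp : 0 < 1 - l * ω := by linarith
  obtain ⟨q, ⟨a, ha, rfl⟩, hq⟩ := h.2.2 (l / (1 - l * ω)) (by positivity) ((1 - l * ω)⁻¹ • w)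
  refine ⟨a.1, a.2, ha, ?_⟩
  have h1 : w = (1 - l * ω) • ((1 - l * ω)⁻¹ • w) := by
    rw [smul_smul, mul_inv_cancel₀ hp.ne', one_smul]
  rw [h1, hq]
  simp only [smul_sub, smul_smul]
  rw [mul_div_cancel₀ _ hp.ne', sub_smul, one_smul]
  rw [show (1 - l * ω) * (l / (1 - l * ω) * ω) = l * ω by field_simp]
  abel

/-- a chain of resolvent steps -/
def Chain (B : Set (X × X)) (h : ℝ) (n : ℕ) (p : ℕ → X) : Prop :=
  ∀ k, k < n → ∃ z, (p (k + 1), z) ∈ B ∧ p (k + 1) - (h / n) • z = p k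

theorem exists_chain {B : Set (X × X)} {ω : ℝ} {T : ℝ → X → X}
    (hB : IsMDissipativeSet (opShift B ω)) (hT : GeneratedBy ω B T) {h : ℝ} (hh : 0 < h)
    (hhω : h * |ω| < 1) (x : X) {ε : ℝ} (hε : 0 < ε) :
    ∃ n : ℕ, 0 < n ∧ ∃ p : ℕ → X, p 0 = x ∧ Chain B h n p ∧ ‖T h x - p n‖ ≤ ε := by
  have hr : ∀ n : ℕ, ∀ y : X, ∃ u, 0 < n → ∃ z, (u, z) ∈ B ∧ u - (h / n) • z = y := by
    intro n y
    rcases Nat.eq_zero_or_pos n with hn | hn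
    · exact ⟨y, fun h' => absurd h' (by omega)⟩
    · have hn' : (1:ℝ) ≤ n := by exact_mod_cast hn
      have h1 : h / n * ω < 1 := by
        calc h / n * ω ≤ h / n * |ω| := by gcongr; exact le_abs_self _
          _ ≤ h / 1 * |ω| := by gcongr
          _ < 1 := by simpa using hhω
      obtain ⟨u, c, h2, h3⟩ := range_of hB (by positivity) h1 y
      exact ⟨u, fun _ => ⟨c, h2, h3⟩⟩
  choose J hJ using hr
  have ht := hT.2.2.2.2 h hh.le x J (fun n hn _ y => hJ n y hn)
  have := (Metric.tendsto_atTop.1 ht) ε hε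
  obtain ⟨N, hN⟩ := this
  refine ⟨N + 1, by omega, fun k => (J (N + 1))^[k] x, rfl, ?_, ?_⟩
  · intro k hk
    obtain ⟨z, hz⟩ := hJ (N + 1) ((J (N + 1))^[k] x) (by omega)
    refine ⟨z, ?_⟩
    simp only [Function.iterate_succ_apply']
    exact hz
  · have := hN (N + 1) (by omega)
    rw [dist_comm, dist_eq_norm] at this
    exact this.le

theorem step_norm {B : Set (X × X)} {W δ : ℝ} (hB : Diss W B) (hδ : 0 ≤ δ)
    {u b q z : X} (hu : (u, b) ∈ B) (hq : (q, z) ∈ B) :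
    (1 - δ * W) * ‖q - u‖ ≤ ‖q - δ • z - u‖ + δ * ‖b‖ := by
  have h1 := hB _ _ _ _ hq hu
  have h2 := real_inner_le_norm (q - δ • z - u) (q - u)
  have h3 := real_inner_le_norm b (q - u)
  rw [inner_sub_left] at h1
  have h4 : q - δ • z - u = (q - u) - δ • z := by abel
  have h5 : inner ℝ (q - δ • z - u) (q - u) = ‖q - u‖ ^ 2 - δ * inner ℝ z (q - u) := by
    rw [h4, inner_sub_left, inner_smul_left, real_inner_self_eq_norm_sq]; simp
  rcases (norm_nonneg (q - u)).eq_or_lt with h0 | h0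
  · rw [← h0]; simp only [mul_zero]; positivity
  · refine le_of_mul_le_mul_right ?_ h0
    have h6 := mul_le_mul_of_nonneg_left h1 hδ
    have h7 := mul_le_mul_of_nonneg_left h3 hδ
    nlinarith

theorem step_sq {B : Set (X × X)} {W δ : ℝ} (hB : Diss W B) (hδ : 0 ≤ δ)
    {u b q z : X} (hu : (u, b) ∈ B) (hq : (q, z) ∈ B) :
    ‖q - u‖ ^ 2 - ‖q - δ • z - u‖ ^ 2 ≤ δ * (2 * (inner ℝ b (q - u) + W * ‖q - u‖ ^ 2)) := by
  have h1 := hB _ _ _ _ hq hu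
  rw [inner_sub_left] at h1
  have h4 : q - δ • z - u = (q - u) - δ • z := by abel
  rw [h4, norm_sub_sq_real (q - u) (δ • z), inner_smul_right, real_inner_comm]
  have h6 := mul_le_mul_of_nonneg_left h1 hδ
  nlinarith [sq_nonneg ‖δ • z‖]

theorem chain_norm {B : Set (X × X)} {W h : ℝ} (hB : Diss W B) (hW : 0 ≤ W) (hh : 0 < h)
    (hhW : h * W ≤ 1 / 2) {n : ℕ} (hn : 0 < n) {p : ℕ → X} (hp : Chain B h n p)
    {u b : X} (hu : (u, b) ∈ B) :
    ∀ k, k ≤ n → (1 - k * (h / n) * W) * ‖p k - u‖ ≤ ‖p 0 - u‖ + k * (h / n) * ‖b‖ := by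
  have hn' : (0:ℝ) < n := by exact_mod_cast hn
  have hd : 0 ≤ h / n := by positivity
  have hle : ∀ k : ℕ, k ≤ n → k * (h / n) ≤ h := by
    intro k hk
    have : (k:ℝ) ≤ n := by exact_mod_cast hk
    calc (k:ℝ) * (h / n) ≤ n * (h / n) := by gcongr
      _ = h := by field_simp
  intro k
  induction k with
  | zero => intro _; simp
  | succ k ih =>
    intro hk
    have ih := ih (by omega)
    obtain ⟨z, hz, hz'⟩ := hp k (by omega)
    have h1 := step_norm hB hd hu hz
    rw [hz'] at h1
    have h2 := hle k (by omega)
    have h2W : (k:ℝ) * (h / n) * W ≤ 1 / 2 := (mul_le_mul_of_nonneg_right h2 hW).trans hhW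
    have h3 : 0 ≤ (k:ℝ) * (h / n) * W := by positivity
    push_cast
    set s := (k:ℝ) * (h / n) * W with hs
    set d := h / (n:ℝ) with hdd
    have hR := norm_nonneg (p (k+1) - u)
    have e1 : (1 - s) * ((1 - d * W) * ‖p (k+1) - u‖) ≤ (1 - s) * (‖p k - u‖ + d * ‖b‖) :=
      mul_le_mul_of_nonneg_left h1 (by linarith)
    have e2 : (1 - s) * (d * ‖b‖) ≤ d * ‖b‖ := by
      have : 0 ≤ d * ‖b‖ := by positivity
      nlinarith
    have e3 : (1 - ((k:ℝ) + 1) * d * W) * ‖p (k+1) - u‖ ≤ (1 - s) * ((1 - d * W) * ‖p (k+1) - u‖) := by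
      have : 0 ≤ s * (d * W) * ‖p (k+1) - u‖ := by positivity
      rw [hs] at this ⊢
      nlinarith
    have e4 : ((k:ℝ) + 1) * d * ‖b‖ = k * d * ‖b‖ + d * ‖b‖ := by ring
    rw [e4]
    nlinarith

theorem chain_norm_le {B : Set (X × X)} {W h : ℝ} (hB : Diss W B) (hW : 0 ≤ W) (hh : 0 < h)
    (hhW : h * W ≤ 1 / 2) {n : ℕ} (hn : 0 < n) {p : ℕ → X} (hp : Chain B h n p)
    {u b : X} (hu : (u, b) ∈ B) {k : ℕ} (hk : k ≤ n) :
    ‖p k - u‖ ≤ 2 * (‖p 0 - u‖ + h * ‖b‖) := by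
  have h1 := chain_norm hB hW hh hhW hn hp hu k hk
  have hn' : (0:ℝ) < n := by exact_mod_cast hn
  have h2 : (k:ℝ) * (h / n) ≤ h := by
    have : (k:ℝ) ≤ n := by exact_mod_cast hk
    calc (k:ℝ) * (h / n) ≤ n * (h / n) := by gcongr
      _ = h := by field_simp
  have h3 : (k:ℝ) * (h / n) * W ≤ 1 / 2 := (mul_le_mul_of_nonneg_right h2 hW).trans hhW
  have h4 := mul_le_mul_of_nonneg_right h2 (norm_nonneg b)
  have h5 := mul_le_mul_of_nonneg_right h3 (norm_nonneg (p k - u))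
  nlinarith

theorem chain_sq {B : Set (X × X)} {W h : ℝ} (hB : Diss W B) (hh : 0 < h)
    {n : ℕ} {p : ℕ → X} (hp : Chain B h n p)
    {u b : X} (hu : (u, b) ∈ B) {E : ℝ}
    (hE : ∀ i, i ≤ n → 2 * (inner ℝ b (p i - u) + W * ‖p i - u‖ ^ 2) ≤ E) (k : ℕ) :
    ∀ j, k + j ≤ n → ‖p (k + j) - u‖ ^ 2 - ‖p k - u‖ ^ 2 ≤ j * (h / n) * E := by
  have hd : 0 ≤ h / n := by positivity
  intro j
  induction j with
  | zero => intro _; simp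
  | succ j ih =>
    intro hj
    have ih := ih (by omega)
    obtain ⟨z, hz, hz'⟩ := hp (k + j) (by omega)
    have h1 := step_sq hB hd hu hz
    rw [hz'] at h1
    have h2 := mul_le_mul_of_nonneg_left (hE (k + j + 1) (by omega)) hd
    rw [← add_assoc]
    push_cast
    nlinarith

theorem chain_sq_full {B : Set (X × X)} {W h : ℝ} (hB : Diss W B) (hh : 0 < h)
    {n : ℕ} (hn : 0 < n) {p : ℕ → X} (hp : Chain B h n p)
    {u b : X} (hu : (u, b) ∈ B) {E : ℝ}
    (hE : ∀ i, i ≤ n → 2 * (inner ℝ b (p i - u) + W * ‖p i - u‖ ^ 2) ≤ E) :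
    ‖p n - u‖ ^ 2 - ‖p 0 - u‖ ^ 2 ≤ h * E := by
  have h1 := chain_sq hB hh hp hu hE 0 n (by omega)
  have hn' : (0:ℝ) < n := by exact_mod_cast hn
  rw [zero_add, mul_div_cancel₀ _ hn'.ne'] at h1
  exact h1

theorem chain_sq_le {B : Set (X × X)} {W h : ℝ} (hB : Diss W B) (hh : 0 < h)
    {n : ℕ} (hn : 0 < n) {p : ℕ → X} (hp : Chain B h n p)
    {u b : X} (hu : (u, b) ∈ B) {E : ℝ} (hE0 : 0 ≤ E)
    (hE : ∀ i, i ≤ n → 2 * (inner ℝ b (p i - u) + W * ‖p i - u‖ ^ 2) ≤ E)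
    {k l : ℕ} (hkl : k ≤ l) (hl : l ≤ n) :
    ‖p l - u‖ ^ 2 - ‖p k - u‖ ^ 2 ≤ h * E := by
  obtain ⟨j, rfl⟩ := Nat.exists_eq_add_of_le hkl
  have h1 := chain_sq hB hh hp hu hE k j hl
  have hn' : (0:ℝ) < n := by exact_mod_cast hn
  have h2 : (j:ℝ) * (h / n) ≤ h := by
    have : (j:ℝ) ≤ n := by exact_mod_cast (by omega : j ≤ n)
    calc (j:ℝ) * (h / n) ≤ n * (h / n) := by gcongr
      _ = h := by field_simp
  exact h1.trans (mul_le_mul_of_nonneg_right h2 hE0)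

/-- closeness of all norms along one chain -/
theorem chain_close {B : Set (X × X)} {W : ℝ} (hB : Diss W B) (hW : 0 ≤ W)
    {u b : X} (hu : (u, b) ∈ B) (ρ : ℝ) :
    ∃ K : ℝ, 0 ≤ K ∧ ∀ (h : ℝ) (n : ℕ) (p : ℕ → X) (y : X), 0 < h → h ≤ 1 → h * W ≤ 1 / 2 → 0 < n →
      Chain B h n p → ‖p 0 - u‖ ≤ ρ → ‖y - p n‖ ≤ h ^ 2 →
      ‖y - u‖ ≤ K ∧ ‖y - u‖ ^ 2 - ‖p n - u‖ ^ 2 ≤ K * h ^ 2 ∧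
      ∀ k, k ≤ n → ‖p k - u‖ ≤ K ∧ ‖p k - u‖ ^ 2 - ‖p 0 - u‖ ^ 2 ≤ K * h ∧
        ‖y - u‖ ^ 2 - ‖p k - u‖ ^ 2 ≤ K * h := by
  set r := 2 * (|ρ| + ‖b‖) with hr
  have hr0 : 0 ≤ r := by positivity
  set E := 2 * (‖b‖ * r + W * r ^ 2) with hE
  have hE0 : 0 ≤ E := by positivity
  refine ⟨E + 2 * r + 1, by positivity, ?_⟩
  intro h n p y hh h1 hhW hn hp hρ hy
  have hpk : ∀ k, k ≤ n → ‖p k - u‖ ≤ r := by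
    intro k hk
    refine (chain_norm_le hB hW hh hhW hn hp hu hk).trans ?_
    have : h * ‖b‖ ≤ 1 * ‖b‖ := by gcongr
    have := le_abs_self ρ
    rw [hr]; linarith
  have hEi : ∀ i, i ≤ n → 2 * (inner ℝ b (p i - u) + W * ‖p i - u‖ ^ 2) ≤ E := by
    intro i hi
    have h2 := real_inner_le_norm b (p i - u)
    have h3 := hpk i hi
    have h4 : ‖b‖ * ‖p i - u‖ ≤ ‖b‖ * r := by gcongr
    have h5 : W * ‖p i - u‖ ^ 2 ≤ W * r ^ 2 := by gcongr
    rw [hE]; linarith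
  have hh2 : h ^ 2 ≤ h := by nlinarith
  have hyu : ‖y - u‖ ≤ ‖p n - u‖ + h ^ 2 := by
    have : y - u = (p n - u) + (y - p n) := by abel
    rw [this]
    exact (norm_add_le _ _).trans (by linarith)
  have hpn := hpk n le_rfl
  have hyn : ‖y - u‖ ^ 2 - ‖p n - u‖ ^ 2 ≤ (2 * r + 1) * h ^ 2 := by
    have h2 : ‖y - u‖ ^ 2 ≤ (‖p n - u‖ + h ^ 2) ^ 2 := by gcongr
    have h3 : ‖p n - u‖ * h ^ 2 ≤ r * h ^ 2 := by gcongr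
    have h4 : h ^ 2 * h ^ 2 ≤ 1 * h ^ 2 := by gcongr; linarith
    nlinarith
  refine ⟨by linarith, ?_, ?_⟩
  · have : 0 ≤ E * h ^ 2 := by positivity
    nlinarith
  · intro k hk
    refine ⟨by linarith [hpk k hk], ?_, ?_⟩
    · have := chain_sq_le hB hh hn hp hu hE0 hEi (Nat.zero_le k) hk
      have h3 : 0 ≤ (2 * r + 1) * h := by positivity
      nlinarith
    · have := chain_sq_le hB hh hn hp hu hE0 hEi hk le_rfl
      have h3 : (2 * r + 1) * h ^ 2 ≤ (2 * r + 1) * h := by gcongr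
      nlinarith

/-- two concatenated chains from `x` to `y` to `z` -/
structure Conf (A B : Set (X × X)) (W ρ h : ℝ) (x y z : X) (n m : ℕ) (p q : ℕ → X) : Prop where
  hh : 0 < h
  h1 : h ≤ 1
  hW : h * W ≤ 1 / 2
  hn : 0 < n
  hm : 0 < m
  p0 : p 0 = x
  q0 : q 0 = y
  cp : Chain B h n p
  cq : Chain A h m q
  ep : ‖y - p n‖ ≤ h ^ 2
  eq : ‖z - q m‖ ≤ h ^ 2
  hx : ‖x‖ ≤ ρ
  hz : ‖z - x‖ ≤ ρ * h

theorem conf_close {A B : Set (X × X)} {W : ℝ} (hA : Diss W A) (hB : Diss W B) (hW : 0 ≤ W)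
    {v a b : X} (ha : (v, a) ∈ A) (hb : (v, b) ∈ B) (ρ : ℝ) :
    ∃ K : ℝ, 0 ≤ K ∧ ∀ (h : ℝ) (x y z : X) (n m : ℕ) (p q : ℕ → X), Conf A B W ρ h x y z n m p q →
      (∀ k, k ≤ n → ‖p k - v‖ ≤ K ∧ |‖p k - v‖ ^ 2 - ‖x - v‖ ^ 2| ≤ K * h) ∧
      (∀ k, k ≤ m → ‖q k - v‖ ≤ K ∧ |‖q k - v‖ ^ 2 - ‖x - v‖ ^ 2| ≤ K * h) ∧
      ‖y - v‖ ^ 2 - ‖p n - v‖ ^ 2 ≤ K * h ^ 2 ∧ ‖z - v‖ ^ 2 - ‖q m - v‖ ^ 2 ≤ K * h ^ 2 := by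
  obtain ⟨K1, hK1, H1⟩ := chain_close hB hW hb (|ρ| + ‖v‖)
  obtain ⟨K2, hK2, H2⟩ := chain_close hA hW ha K1
  set K3 := |ρ| * (K2 + (|ρ| + ‖v‖)) with hK3d
  have hK3 : 0 ≤ K3 := by positivity
  refine ⟨K1 + K2 + K3, by positivity, ?_⟩
  intro h x y z n m p q c
  have hxv : ‖x - v‖ ≤ |ρ| + ‖v‖ := (norm_sub_le _ _).trans (by linarith [c.hx, le_abs_self ρ])
  obtain ⟨a1, a2, a3⟩ := H1 h n p y c.hh c.h1 c.hW c.hn c.cp (by rw [c.p0]; exact hxv) c.ep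
  obtain ⟨b1, b2, b3⟩ := H2 h m q z c.hh c.h1 c.hW c.hm c.cq (by rw [c.q0]; exact a1) c.eq
  rw [c.p0] at a3
  rw [c.q0] at b3
  have a4 := (a3 0 (Nat.zero_le _)).2.2
  have b4 := (b3 0 (Nat.zero_le _)).2.2
  rw [c.p0] at a4
  rw [c.q0] at b4
  have hh := c.hh
  have hzx : ‖x - v‖ ^ 2 - ‖z - v‖ ^ 2 ≤ K3 * h := by
    have e1 : ‖x - v‖ ≤ ‖z - v‖ + ‖z - x‖ := by
      have : x - v = (z - v) - (z - x) := by abel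
      rw [this]; exact norm_sub_le _ _
    have e2 : ‖z - x‖ ≤ |ρ| * h := c.hz.trans (by gcongr; exact le_abs_self _)
    have e3 : (‖x - v‖ - ‖z - v‖) * (‖x - v‖ + ‖z - v‖) ≤ (|ρ| * h) * (‖x - v‖ + ‖z - v‖) := by
      gcongr; linarith
    have e4 : (|ρ| * h) * (‖x - v‖ + ‖z - v‖) ≤ (|ρ| * h) * ((|ρ| + ‖v‖) + K2) := by gcongr
    rw [hK3d]; nlinarith
  have m1 : 0 ≤ K1 * h := by positivity
  have m2 : 0 ≤ K2 * h := by positivity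
  have m3 : 0 ≤ K3 * h := by positivity
  have n1 : 0 ≤ K1 * h ^ 2 := by positivity
  have n2 : 0 ≤ K2 * h ^ 2 := by positivity
  have n3 : 0 ≤ K3 * h ^ 2 := by positivity
  refine ⟨?_, ?_, by nlinarith, by nlinarith⟩
  · intro k hk
    obtain ⟨r1, r2, r3⟩ := a3 k hk
    refine ⟨by linarith, ?_⟩
    rw [abs_le]
    constructor <;> nlinarith
  · intro k hk
    obtain ⟨r1, r2, r3⟩ := b3 k hk
    refine ⟨by linarith, ?_⟩
    rw [abs_le]
    constructor <;> nlinarith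

theorem weak_aux {e r x v v0 : X} {R η κ : ℝ} (hη : 0 < η) (hR : ‖r - x‖ ≤ R)
    (hv : ‖e + v0 - v‖ ≤ η / (2 * (R + 1)))
    (h0 : |‖r - v0‖ ^ 2 - ‖x - v0‖ ^ 2| ≤ κ) (h1 : |‖r - v‖ ^ 2 - ‖x - v‖ ^ 2| ≤ κ)
    (hκ : κ ≤ η / 2) : |inner ℝ e (r - x)| ≤ η := by
  have hR0 : 0 ≤ R := (norm_nonneg _).trans hR
  have e1 : inner ℝ e (r - x) = inner ℝ (e + v0 - v) (r - x) +
      ((‖r - v0‖ ^ 2 - ‖x - v0‖ ^ 2) - (‖r - v‖ ^ 2 - ‖x - v‖ ^ 2)) / 2 := by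
    simp only [norm_sub_sq_real, inner_sub_left, inner_add_left, inner_sub_right]
    rw [real_inner_comm r v0, real_inner_comm r v, real_inner_comm x v0, real_inner_comm x v]
    ring
  have e2 : |inner ℝ (e + v0 - v) (r - x)| ≤ η / 2 := by
    refine (abs_real_inner_le_norm _ _).trans ?_
    calc ‖e + v0 - v‖ * ‖r - x‖ ≤ η / (2 * (R + 1)) * R := by gcongr
      _ = η / 2 * (R / (R + 1)) := by field_simp
      _ ≤ η / 2 * 1 := by
        gcongr
        rw [div_le_one (by positivity)]; linarith
      _ = η / 2 := by ring
  rw [e1]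
  rw [abs_le] at *
  constructor <;> linarith

theorem conf_weak {A B : Set (X × X)} {W : ℝ} (hA : Diss W A) (hB : Diss W B) (hW : 0 ≤ W)
    (hD : Dense {v : X | ∃ a b, (v, a) ∈ A ∧ (v, b) ∈ B}) (e : X) (ρ : ℝ) {η : ℝ} (hη : 0 < η) :
    ∃ h0 : ℝ, 0 < h0 ∧ ∀ (h : ℝ) (x y z : X) (n m : ℕ) (p q : ℕ → X),
      Conf A B W ρ h x y z n m p q → h < h0 →
      (∀ k, k ≤ n → |inner ℝ e (p k - x)| ≤ η) ∧ (∀ k, k ≤ m → |inner ℝ e (q k - x)| ≤ η) := by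
  obtain ⟨v0, a0, b0, ha0, hb0⟩ := hD.nonempty
  obtain ⟨K0, hK0, H0⟩ := conf_close hA hB hW ha0 hb0 ρ
  set R := K0 + (|ρ| + ‖v0‖) with hR
  have hR0 : 0 ≤ R := by positivity
  obtain ⟨v, hv, a, b, ha, hb⟩ := Metric.dense_iff.1 hD (e + v0) (η / (2 * (R + 1)))
    (by positivity)
  rw [Metric.mem_ball, dist_comm, dist_eq_norm] at hv
  obtain ⟨K, hK, H⟩ := conf_close hA hB hW ha hb ρ
  refine ⟨η / (2 * (K0 + K + 1)), by positivity, ?_⟩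
  intro h x y z n m p q c hh
  have hxv : ‖x - v0‖ ≤ |ρ| + ‖v0‖ := (norm_sub_le _ _).trans (by linarith [c.hx, le_abs_self ρ])
  obtain ⟨A1, A2, -⟩ := H0 h x y z n m p q c
  obtain ⟨B1, B2, -⟩ := H h x y z n m p q c
  have hh0 := c.hh
  have hκ : (K0 + K) * h ≤ η / 2 := by
    rw [lt_div_iff₀ (by positivity)] at hh
    nlinarith
  have g0 : K0 * h ≤ (K0 + K) * h := by gcongr; linarith
  have g1 : K * h ≤ (K0 + K) * h := by gcongr; linarith
  have hn : ∀ r, ‖r - v0‖ ≤ K0 → ‖r - x‖ ≤ R := by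
    intro r hr
    have : r - x = (r - v0) - (x - v0) := by abel
    rw [this]; exact (norm_sub_le _ _).trans (by linarith)
  constructor
  · intro k hk
    exact weak_aux hη (hn _ (A1 k hk).1) hv.le ((A1 k hk).2.trans g0) ((B1 k hk).2.trans g1) hκ
  · intro k hk
    exact weak_aux hη (hn _ (A2 k hk).1) hv.le ((A2 k hk).2.trans g0) ((B2 k hk).2.trans g1) hκ

theorem conf_main {A B : Set (X × X)} {W : ℝ} (hA : Diss W A) (hB : Diss W B) (hW : 0 ≤ W)
    (hD : Dense {v : X | ∃ a b, (v, a) ∈ A ∧ (v, b) ∈ B}) {u a b : X} (ha : (u, a) ∈ A)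
    (hb : (u, b) ∈ B) (ρ : ℝ) {η : ℝ} (hη : 0 < η) :
    ∃ h0 : ℝ, 0 < h0 ∧ ∀ (h : ℝ) (x y z : X) (n m : ℕ) (p q : ℕ → X),
      Conf A B W ρ h x y z n m p q → h < h0 →
      inner ℝ (z - x) (x - u) ≤ h * (inner ℝ (a + b) (x - u) + 2 * W * ‖x - u‖ ^ 2 + η) := by
  obtain ⟨ha0, ha0p, Ha⟩ := conf_weak hA hB hW hD a ρ (η := η / 4) (by positivity)
  obtain ⟨hb0, hb0p, Hb⟩ := conf_weak hA hB hW hD b ρ (η := η / 4) (by positivity)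
  obtain ⟨K, hK, H⟩ := conf_close hA hB hW ha hb ρ
  set M := 2 * W * K + K with hM
  have hM0 : 0 ≤ M := by positivity
  refine ⟨min (min ha0 hb0) (η / (2 * (M + 1))), by positivity, ?_⟩
  intro h x y z n m p q c hlt
  simp only [lt_min_iff] at hlt
  obtain ⟨⟨l1, l2⟩, l3⟩ := hlt
  obtain ⟨c1, c2, c3, c4⟩ := H h x y z n m p q c
  have hh := c.hh
  have hMh : M * h ≤ η / 2 := by
    rw [lt_div_iff₀ (by positivity)] at l3
    nlinarith
  have P := chain_sq_full hB hh c.hn c.cp hb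
    (E := 2 * ((inner ℝ b (x - u) + η / 4) + W * (‖x - u‖ ^ 2 + K * h))) (by
      intro i hi
      have e1 := (Hb h x y z n m p q c l2).1 i hi
      have e2 := (c1 i hi).2
      have e3 : inner ℝ b (p i - u) = inner ℝ b (x - u) + inner ℝ b (p i - x) := by
        rw [← inner_add_right]; congr 1; abel
      rw [abs_le] at e1 e2
      rw [e3]
      have : W * ‖p i - u‖ ^ 2 ≤ W * (‖x - u‖ ^ 2 + K * h) := by gcongr; linarith
      linarith)
  have Q := chain_sq_full hA hh c.hm c.cq ha
    (E := 2 * ((inner ℝ a (x - u) + η / 4) + W * (‖x - u‖ ^ 2 + K * h))) (by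
      intro i hi
      have e1 := (Ha h x y z n m p q c l1).2 i hi
      have e2 := (c2 i hi).2
      have e3 : inner ℝ a (q i - u) = inner ℝ a (x - u) + inner ℝ a (q i - x) := by
        rw [← inner_add_right]; congr 1; abel
      rw [abs_le] at e1 e2
      rw [e3]
      have : W * ‖q i - u‖ ^ 2 ≤ W * (‖x - u‖ ^ 2 + K * h) := by gcongr; linarith
      linarith)
  rw [c.p0] at P
  rw [c.q0] at Q
  have F : 2 * inner ℝ (z - x) (x - u) ≤ ‖z - u‖ ^ 2 - ‖x - u‖ ^ 2 := by
    have : z - u = (z - x) + (x - u) := by abel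
    rw [this, norm_add_sq_real]
    nlinarith [sq_nonneg ‖z - x‖]
  have G : h * (M * h) ≤ h * (η / 2) := by gcongr
  rw [inner_add_left]
  rw [hM] at G
  nlinarith

theorem exp_small {s : ℝ} (h0 : 0 ≤ s) (h1 : s ≤ 1) : Real.exp s ≤ 1 + 2 * s := by
  have := Real.abs_exp_sub_one_le (x := s) (by rwa [abs_of_nonneg h0])
  rw [abs_of_nonneg h0, abs_le] at this
  linarith

theorem semi_near {B : Set (X × X)} {ω : ℝ} {T : ℝ → X → X}
    (hB : IsMDissipativeSet (opShift B ω)) (hT : GeneratedBy ω B T) {h : ℝ} (hh : 0 < h)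
    (hhω : h * |ω| ≤ 1 / 2) {v b : X} (hv : (v, b) ∈ B) : ‖T h v - v‖ ≤ 2 * h * ‖b‖ := by
  apply le_of_forall_pos_le_add
  intro ε hε
  obtain ⟨n, hn, p, p0, hp, hpn⟩ := exists_chain hB hT hh (by linarith) v hε
  have h1 := chain_norm_le (diss_of le_rfl hB.1) (abs_nonneg ω) hh hhω hn hp hv (le_refl n)
  rw [p0, sub_self, norm_zero] at h1
  have : T h v - v = (T h v - p n) + (p n - v) := by abel
  rw [this]
  refine (norm_add_le _ _).trans ?_
  linarith

/-- all standing hypotheses -/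
structure Setup (ω : ℝ) (A B : Set (X × X)) (S T : ℝ → X → X) : Prop where
  hA : IsMDissipativeSet (opShift A ω)
  hB : IsMDissipativeSet (opShift B ω)
  hS : GeneratedBy ω A S
  hT : GeneratedBy ω B T
  hD : Dense {v : X | ∃ a b, (v, a) ∈ A ∧ (v, b) ∈ B}

theorem semi_lip {B : Set (X × X)} {ω : ℝ} {T : ℝ → X → X} (hT : GeneratedBy ω B T)
    {h : ℝ} (hh : 0 < h) (x y : X) : ‖T h x - T h y‖ ≤ Real.exp (h * |ω|) * ‖x - y‖ := by
  refine (hT.2.2.1 h hh.le x y).trans ?_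
  have : ω * h ≤ h * |ω| := by
    rw [mul_comm]
    exact mul_le_mul_of_nonneg_left (le_abs_self _) hh.le
  gcongr

theorem F_lip {ω : ℝ} {A B : Set (X × X)} {S T : ℝ → X → X} (s : Setup ω A B S T)
    {h : ℝ} (hh : 0 < h) (hhω : 4 * |ω| * h ≤ 1) (x y : X) :
    ‖S h (T h x) - S h (T h y)‖ ≤ (1 + 4 * |ω| * h) * ‖x - y‖ := by
  have h1 := semi_lip s.hS hh (T h x) (T h y)
  have h2 := semi_lip s.hT hh x y
  have h3 : Real.exp (2 * |ω| * h) ≤ 1 + 2 * (2 * |ω| * h) :=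
    exp_small (by positivity) (by nlinarith [abs_nonneg ω])
  calc ‖S h (T h x) - S h (T h y)‖ ≤ Real.exp (h * |ω|) * (Real.exp (h * |ω|) * ‖x - y‖) :=
        h1.trans (by gcongr)
    _ = Real.exp (2 * |ω| * h) * ‖x - y‖ := by
        rw [← mul_assoc, ← Real.exp_add]; ring_nf
    _ ≤ (1 + 2 * (2 * |ω| * h)) * ‖x - y‖ := by gcongr
    _ = _ := by ring

theorem F_near {ω : ℝ} {A B : Set (X × X)} {S T : ℝ → X → X} (s : Setup ω A B S T)
    {h : ℝ} (hh : 0 < h) (hhω : 4 * |ω| * h ≤ 1) {v a b : X} (ha : (v, a) ∈ A)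
    (hb : (v, b) ∈ B) : ‖S h (T h v) - v‖ ≤ (4 * ‖b‖ + 2 * ‖a‖) * h := by
  have hW := abs_nonneg ω
  have h1 := semi_lip s.hS hh (T h v) v
  have h2 := semi_near s.hA s.hS hh (by nlinarith) ha
  have h3 := semi_near s.hB s.hT hh (by nlinarith) hb
  have h4 : Real.exp (h * |ω|) ≤ 1 + 2 * (h * |ω|) :=
    exp_small (by positivity) (by nlinarith [abs_nonneg ω])
  have h5 : Real.exp (h * |ω|) ≤ 2 := by nlinarith
  have h6 : S h (T h v) - v = (S h (T h v) - S h v) + (S h v - v) := by abel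
  rw [h6]
  refine (norm_add_le _ _).trans ?_
  have h7 : Real.exp (h * |ω|) * ‖T h v - v‖ ≤ 2 * (2 * h * ‖b‖) := by gcongr
  linarith

theorem res_exists [CompleteSpace X] {F : X → X} {N h l : ℝ} (hN : 0 ≤ N) (hh : 0 < h) (hl : 0 < l)
    (hlN : l * N ≤ 1 / 2) (hF : ∀ x y, ‖F x - F y‖ ≤ (1 + N * h) * ‖x - y‖) (w : X) :
    ∃ g, h • (g - w) = l • (F g - g) := by
  have hK : 0 ≤ l * (1 + N * h) / (h + l) := by positivity
  let G : X → X := fun g => (h / (h + l)) • w + (l / (h + l)) • F g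
  have hG : ContractingWith (Real.toNNReal (l * (1 + N * h) / (h + l))) G := by
    constructor
    · rw [← NNReal.coe_lt_coe]
      rw [Real.coe_toNNReal _ hK, NNReal.coe_one]
      rw [div_lt_one (by positivity)]
      nlinarith
    · apply LipschitzWith.of_dist_le_mul
      intro x y
      rw [dist_eq_norm, dist_eq_norm, Real.coe_toNNReal _ hK]
      simp only [G]
      rw [add_sub_add_left_eq_sub, ← smul_sub, norm_smul, Real.norm_eq_abs,
        abs_of_pos (by positivity)]
      calc l / (h + l) * ‖F x - F y‖ ≤ l / (h + l) * ((1 + N * h) * ‖x - y‖) := by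
            gcongr; exact hF x y
        _ = _ := by ring
  have hfix := hG.fixedPoint_isFixedPt
  set g := ContractingWith.fixedPoint G hG
  refine ⟨g, ?_⟩
  have h1 : (h + l) • g = h • w + l • F g := by
    have h2 : g = (h / (h + l)) • w + (l / (h + l)) • F g := hfix.symm
    have h3 : h + l ≠ 0 := by positivity
    conv_lhs => rw [h2]
    rw [smul_add, smul_smul, smul_smul, mul_div_cancel₀ _ h3, mul_div_cancel₀ _ h3]
  rw [add_smul] at h1
  rw [smul_sub, smul_sub, sub_eq_sub_iff_add_eq_add, h1, add_comm]

theorem res_lip {F : X → X} {N h l : ℝ} (hh : 0 < h) (hl : 0 < l)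
    (hF : ∀ x y, ‖F x - F y‖ ≤ (1 + N * h) * ‖x - y‖) {w w' g g' : X}
    (hg : h • (g - w) = l • (F g - g)) (hg' : h • (g' - w') = l • (F g' - g')) :
    (1 - l * N) * ‖g - g'‖ ≤ ‖w - w'‖ := by
  have h1 : (h + l) • (g - g') = h • (w - w') + l • (F g - F g') := by
    have e1 : h • g - h • w = l • F g - l • g := by rw [← smul_sub, hg, smul_sub]
    have e2 : h • g' - h • w' = l • F g' - l • g' := by rw [← smul_sub, hg', smul_sub]
    rw [sub_eq_sub_iff_add_eq_add] at e1 e2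
    have e3 := congrArg₂ (· - ·) e1 e2
    simp only [add_smul, smul_sub]
    calc _ = (h • g + l • g) - (h • g' + l • g') := by abel
      _ = _ := e3
      _ = _ := by abel
  have h2 := congrArg norm h1
  rw [norm_smul, Real.norm_eq_abs, abs_of_pos (by positivity)] at h2
  have h3 := norm_add_le (h • (w - w')) (l • (F g - F g'))
  rw [norm_smul, norm_smul, Real.norm_eq_abs, Real.norm_eq_abs, abs_of_pos hh, abs_of_pos hl] at h3
  have h4 := mul_le_mul_of_nonneg_left (hF g g') hl.le
  refine le_of_mul_le_mul_left ?_ hh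
  nlinarith

theorem res_near {F : X → X} {N h l L : ℝ} (hN : 0 ≤ N) (hh : 0 < h) (hl : 0 < l)
    (hlN : l * N ≤ 1 / 2)
    (hF : ∀ x y, ‖F x - F y‖ ≤ (1 + N * h) * ‖x - y‖) {w g x : X}
    (hg : h • (g - w) = l • (F g - g)) (hx : ‖F x - x‖ ≤ L * h) :
    ‖g - x‖ ≤ (1 + 2 * (l * N)) * (‖w - x‖ + l * L) := by
  have h1 : h • (x - (x - (l / h) • (F x - x))) = l • (F x - x) := by
    rw [sub_sub_cancel, smul_smul, mul_div_cancel₀ _ hh.ne']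
  have h2 := res_lip hh hl hF hg h1
  have h3 : ‖w - (x - (l / h) • (F x - x))‖ ≤ ‖w - x‖ + l * L := by
    have : w - (x - (l / h) • (F x - x)) = (w - x) + (l / h) • (F x - x) := by abel
    rw [this]
    refine (norm_add_le _ _).trans ?_
    rw [norm_smul, Real.norm_eq_abs, abs_of_pos (by positivity)]
    have : l / h * ‖F x - x‖ ≤ l / h * (L * h) := by gcongr
    have e : l / h * (L * h) = l * L := by field_simp
    linarith
  have h4 := h2.trans h3
  have hs : 0 ≤ l * N := by positivity
  have h5 := mul_le_mul_of_nonneg_left h4 (by linarith : 0 ≤ 1 + 2 * (l * N))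
  have h6 : 0 ≤ l * N * (1 - 2 * (l * N)) * ‖g - x‖ := by
    have : 0 ≤ 1 - 2 * (l * N) := by linarith
    positivity
  nlinarith

theorem res_conv {ω : ℝ} {A B : Set (X × X)} {S T : ℝ → X → X} (s : Setup ω A B S T)
    {l : ℝ} (hl : 0 < l) (hlω : l * (4 * |ω|) ≤ 1 / 2) {u a b w : X} (ha : (u, a) ∈ A)
    (hb : (u, b) ∈ B) (hu : u - l • (a + b) = w) {η : ℝ} (hη : 0 < η) :
    ∃ h0 : ℝ, 0 < h0 ∧ ∀ h, 0 < h → h < h0 → ∀ g, h • (g - w) = l • (S h (T h g) - g) →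
      ‖g - u‖ ≤ η := by
  have hW := abs_nonneg ω
  set L := 4 * ‖b‖ + 2 * ‖a‖ with hL
  set ρ0 := 2 * (‖w - u‖ + l * L) with hρ0
  have hρ00 : 0 ≤ ρ0 := by positivity
  set ρ := (ρ0 + ‖u‖) + (ρ0 + ‖u‖ + ‖w‖) / l with hρ
  obtain ⟨h0, hp0, H⟩ := conf_main (diss_of le_rfl s.hA.1) (diss_of le_rfl s.hB.1) hW s.hD ha hb ρ
    (η := η ^ 2 / (2 * l)) (by positivity)
  refine ⟨min (min h0 1) (1 / (4 * |ω| + 1)), by positivity, ?_⟩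
  intro h hh hlt g hg
  simp only [lt_min_iff] at hlt
  obtain ⟨⟨l1, l2⟩, l3⟩ := hlt
  have hhω : 4 * |ω| * h ≤ 1 := by
    rw [lt_div_iff₀ (by positivity)] at l3
    nlinarith
  have n1 : ‖g - u‖ ≤ ρ0 := by
    refine (res_near (by positivity) hh hl hlω (F_lip s hh hhω) hg
      (F_near s hh hhω ha hb)).trans ?_
    rw [hρ0]
    gcongr
    linarith
  have n2 : ‖g‖ ≤ ρ0 + ‖u‖ := by
    have : g = (g - u) + u := by abel
    rw [this]; exact (norm_add_le _ _).trans (by linarith)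
  have z1 : S h (T h g) - g = (h / l) • (g - w) := by
    have : (h / l) • (g - w) = l⁻¹ • (h • (g - w)) := by rw [smul_smul]; congr 1; field_simp
    rw [this, hg, smul_smul, inv_mul_cancel₀ hl.ne', one_smul]
  have z2 : ‖S h (T h g) - g‖ ≤ ρ * h := by
    rw [z1, norm_smul, Real.norm_eq_abs, abs_of_pos (by positivity)]
    have : ‖g - w‖ ≤ ρ0 + ‖u‖ + ‖w‖ := (norm_sub_le _ _).trans (by linarith)
    calc h / l * ‖g - w‖ ≤ h / l * (ρ0 + ‖u‖ + ‖w‖) := by gcongr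
      _ = (ρ0 + ‖u‖ + ‖w‖) / l * h := by ring
      _ ≤ ρ * h := by
        gcongr; rw [hρ]
        have : 0 ≤ ρ0 + ‖u‖ := by positivity
        linarith
  obtain ⟨n, hn, p, p0, hp, hpn⟩ := exists_chain s.hB s.hT hh (by nlinarith) g
    (ε := h ^ 2) (by positivity)
  obtain ⟨m, hm, q, q0, hq, hqm⟩ := exists_chain s.hA s.hS hh (by nlinarith) (T h g)
    (ε := h ^ 2) (by positivity)
  have key := H h g (T h g) (S h (T h g)) n m p q
    ⟨hh, l2.le, by nlinarith, hn, hm, p0, q0, hp, hq, hpn, hqm, by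
      have : 0 ≤ (ρ0 + ‖u‖ + ‖w‖) / l := by positivity
      linarith, z2⟩ l1
  have e1 : g - w = (g - u) + l • (a + b) := by rw [← hu]; abel
  rw [z1, e1, inner_smul_left, inner_add_left, inner_smul_left, real_inner_self_eq_norm_sq] at key
  simp only [conj_trivial] at key
  have e2 : h / l * (‖g - u‖ ^ 2 + l * inner ℝ (a + b) (g - u)) =
      h * (‖g - u‖ ^ 2 / l + inner ℝ (a + b) (g - u)) := by field_simp
  rw [e2] at key
  have k1 := le_of_mul_le_mul_left key hh
  have k2 : ‖g - u‖ ^ 2 / l ≤ 2 * |ω| * ‖g - u‖ ^ 2 + η ^ 2 / (2 * l) := by linarith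
  have k3 : ‖g - u‖ ^ 2 ≤ l * (2 * |ω| * ‖g - u‖ ^ 2 + η ^ 2 / (2 * l)) := by
    rwa [div_le_iff₀' hl] at k2
  have k4 : l * (η ^ 2 / (2 * l)) = η ^ 2 / 2 := by field_simp
  have k5 : l * (4 * |ω|) * ‖g - u‖ ^ 2 ≤ 1 / 2 * ‖g - u‖ ^ 2 := by gcongr
  have k6 : ‖g - u‖ ^ 2 ≤ η ^ 2 := by nlinarith
  exact (sq_le_sq₀ (norm_nonneg _) hη.le).1 k6

theorem iter_conv [CompleteSpace X] {ω : ℝ} {A B : Set (X × X)} {S T : ℝ → X → X}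
    (s : Setup ω A B S T) {l : ℝ} (hl : 0 < l) (hlω : l * (4 * |ω|) ≤ 1 / 2) {u : ℕ → X}
    (hu : ∀ j, ∃ c, (u (j + 1), c) ∈ opSum A B ∧ u (j + 1) - l • c = u j) (j : ℕ) :
    ∀ η : ℝ, 0 < η → ∃ h0 : ℝ, 0 < h0 ∧ ∀ h, 0 < h → h < h0 → ∀ y : ℕ → X, y 0 = u 0 →
      (∀ j, h • (y (j + 1) - y j) = l • (S h (T h (y (j + 1))) - y (j + 1))) →
      ‖y j - u j‖ ≤ η := by
  induction j with
  | zero =>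
    intro η hη
    refine ⟨1, one_pos, ?_⟩
    intro h _ _ y h0 _
    rw [h0, sub_self, norm_zero]; exact hη.le
  | succ j ih =>
    intro η hη
    obtain ⟨h1, h1p, H1⟩ := ih (η / 4) (by positivity)
    obtain ⟨c, ⟨a, b, ha, hb, hc⟩, hcu⟩ := hu j
    simp only at ha hb hc
    rw [hc] at hcu
    obtain ⟨h2, h2p, H2⟩ := res_conv s hl hlω ha hb hcu (η := η / 2) (by positivity)
    refine ⟨min (min h1 h2) (1 / (4 * |ω| + 1)), by positivity, ?_⟩
    intro h hh hlt y y0 hy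
    simp only [lt_min_iff] at hlt
    obtain ⟨⟨l1, l2⟩, l3⟩ := hlt
    have hhω : 4 * |ω| * h ≤ 1 := by
      rw [lt_div_iff₀ (by positivity)] at l3
      nlinarith
    obtain ⟨g, hg⟩ := res_exists (by positivity) hh hl hlω (F_lip s hh hhω) (u j)
    have e1 := res_lip hh hl (F_lip s hh hhω) (hy j) hg
    have e2 := H1 h hh l1 y y0 hy
    have e3 := H2 h hh l2 g hg
    have e4 : ‖y (j + 1) - g‖ ≤ η / 2 := by
      have := norm_nonneg (y (j + 1) - g)
      nlinarith
    have : y (j + 1) - u (j + 1) = (y (j + 1) - g) + (g - u (j + 1)) := by abel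
    rw [this]
    exact (norm_add_le _ _).trans (by linarith)

theorem sqrt_conc {h l a b c : ℝ} (hh : 0 < h) (hl : 0 < l) (ha : 0 ≤ a) (hb : 0 ≤ b)
    (hc : 0 ≤ c) (hs : h * a + l * b = (h + l) * c) :
    h * √a + l * √b ≤ (h + l) * √c := by
  refine (sq_le_sq₀ (by positivity) (by positivity)).1 ?_
  have e1 := Real.sq_sqrt ha
  have e2 := Real.sq_sqrt hb
  have e3 := Real.sq_sqrt hc
  have e4 : (h + l) * (h * a + l * b) = ((h + l) * √c) ^ 2 := by
    rw [hs, mul_pow, e3]; ring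
  rw [← e4]
  have h5 : 0 ≤ h * l * (√a - √b) ^ 2 := by positivity
  have h6 : h * l * (√a - √b) ^ 2 =
      (h + l) * (h * √a ^ 2 + l * √b ^ 2) - (h * √a + l * √b) ^ 2 := by ring
  rw [h6, e1, e2] at h5
  linarith

theorem explicit_near {F : X → X} {N h L : ℝ} (hN : 0 ≤ N) (hh : 0 < h) (hL : 0 ≤ L)
    (hF : ∀ x y, ‖F x - F y‖ ≤ (1 + N * h) * ‖x - y‖) {x : X} (hx : ‖F x - x‖ ≤ L * h) (k : ℕ) :
    ‖F^[k] x - x‖ ≤ (1 + N * h) ^ k * (k * h * L) := by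
  induction k with
  | zero => simp
  | succ k ih =>
    have hP : 1 ≤ 1 + N * h := by nlinarith [mul_nonneg hN hh.le]
    rw [Function.iterate_succ_apply']
    have : F (F^[k] x) - x = (F (F^[k] x) - F x) + (F x - x) := by abel
    rw [this]
    refine (norm_add_le _ _).trans ?_
    have h1 := hF (F^[k] x) x
    have h2 : (1 + N * h) * ‖F^[k] x - x‖ ≤ (1 + N * h) * ((1 + N * h) ^ k * (k * h * L)) := by
      gcongr
    have h3 : 1 * (h * L) ≤ (1 + N * h) ^ (k + 1) * (h * L) := by
      gcongr
      exact one_le_pow₀ hP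
    push_cast
    rw [pow_succ] at *
    nlinarith

theorem implicit_near {F : X → X} {N h l L : ℝ} (hN : 0 ≤ N) (hh : 0 < h) (hl : 0 < l)
    (hlN : l * N ≤ 1 / 2) (hL : 0 ≤ L)
    (hF : ∀ x y, ‖F x - F y‖ ≤ (1 + N * h) * ‖x - y‖) {x : X} (hx : ‖F x - x‖ ≤ L * h)
    {y : ℕ → X} (y0 : y 0 = x) (hy : ∀ j, h • (y (j + 1) - y j) = l • (F (y (j + 1)) - y (j + 1)))
    (j : ℕ) : ‖y j - x‖ ≤ (1 + 2 * (l * N)) ^ j * (j * l * L) := by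
  induction j with
  | zero => simp [y0]
  | succ j ih =>
    have h1 := res_near hN hh hl hlN hF (hy j) hx
    have hP : 1 ≤ 1 + 2 * (l * N) := by nlinarith [mul_nonneg hl.le hN]
    have h3 : 1 * (l * L) ≤ (1 + 2 * (l * N)) ^ j * (l * L) := by
      gcongr
      exact one_le_pow₀ hP
    calc _ ≤ _ := h1
      _ ≤ (1 + 2 * (l * N)) * ((1 + 2 * (l * N)) ^ j * (j * l * L) +
          (1 + 2 * (l * N)) ^ j * (l * L)) :=
          mul_le_mul_of_nonneg_left (by linarith) (by linarith)
      _ = _ := by push_cast; ring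

theorem kobayashi {F : X → X} {N h l C : ℝ} (hN : 0 ≤ N) (hh : 0 < h) (hl : 0 < l)
    (hC : 0 ≤ C) (hF : ∀ x y, ‖F x - F y‖ ≤ (1 + N * h) * ‖x - y‖) {x : X} (hx : ‖F x - x‖ ≤ C * h)
    {y : ℕ → X} (y0 : y 0 = x) (hy : ∀ j, h • (y (j + 1) - y j) = l • (F (y (j + 1)) - y (j + 1)))
    {m : ℕ} (hm : ∀ j, j ≤ m → ‖y j - x‖ ≤ j * l * C) (k : ℕ) :
    ∀ j, j ≤ m → ‖F^[k] x - y j‖ ≤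
      (1 + N * h) ^ k * (C * √((k * h - j * l) ^ 2 + k * h ^ 2 + j * l ^ 2)) := by
  induction k with
  | zero =>
    intro j hj
    have h1 := hm j hj
    simp only [Function.iterate_zero, id_eq, pow_zero, one_mul, Nat.cast_zero, zero_mul, add_zero]
    rw [norm_sub_rev]
    refine h1.trans ?_
    rw [mul_comm _ C]
    gcongr
    apply Real.le_sqrt_of_sq_le
    have : 0 ≤ (j:ℝ) * l ^ 2 := by positivity
    nlinarith
  | succ k ihk =>
    intro j
    induction j with
    | zero =>
      intro _
      rw [y0]
      refine (explicit_near hN hh hC hF hx (k + 1)).trans ?_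
      rw [mul_comm _ C]
      gcongr
      apply Real.le_sqrt_of_sq_le
      have : 0 ≤ ((k + 1 : ℕ):ℝ) * h ^ 2 := by positivity
      push_cast at *
      nlinarith
    | succ j ihj =>
      intro hj
      have i1 := ihj (by omega)
      have i2 := ihk (j + 1) hj
      have e1 : (h + l) • (F^[k + 1] x - y (j + 1)) =
          h • (F^[k + 1] x - y j) + l • (F (F^[k] x) - F (y (j + 1))) := by
        have e := hy j
        rw [smul_sub, smul_sub, sub_eq_sub_iff_add_eq_add] at e
        rw [Function.iterate_succ_apply']
        simp only [add_smul, smul_sub]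
        have e' : h • y (j + 1) + l • y (j + 1) = h • y j + l • F (y (j + 1)) := by
          rw [e, add_comm]
        calc _ = h • F (F^[k] x) + l • F (F^[k] x) - (h • y (j + 1) + l • y (j + 1)) := by abel
          _ = _ := by rw [e']; abel
      have e2 := congrArg norm e1
      rw [norm_smul, Real.norm_eq_abs, abs_of_pos (by positivity)] at e2
      have e3 := norm_add_le (h • (F^[k + 1] x - y j)) (l • (F (F^[k] x) - F (y (j + 1))))
      rw [norm_smul, norm_smul, Real.norm_eq_abs, Real.norm_eq_abs, abs_of_pos hh,
        abs_of_pos hl] at e3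
      have e4 := hF (F^[k] x) (y (j + 1))
      set P := 1 + N * h with hP
      have hP0 : 0 ≤ P := by positivity
      have c := sqrt_conc (h := h) (l := l)
        (a := (((k + 1 : ℕ):ℝ) * h - j * l) ^ 2 + ((k + 1 : ℕ):ℝ) * h ^ 2 + j * l ^ 2)
        (b := ((k:ℝ) * h - ((j + 1 : ℕ):ℝ) * l) ^ 2 + k * h ^ 2 + ((j + 1 : ℕ):ℝ) * l ^ 2)
        (c := (((k + 1 : ℕ):ℝ) * h - ((j + 1 : ℕ):ℝ) * l) ^ 2 + ((k + 1 : ℕ):ℝ) * h ^ 2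
          + ((j + 1 : ℕ):ℝ) * l ^ 2) hh hl (by positivity) (by positivity) (by positivity)
          (by push_cast; ring)
      set s1 := √((((k + 1 : ℕ):ℝ) * h - j * l) ^ 2 + ((k + 1 : ℕ):ℝ) * h ^ 2 + j * l ^ 2)
      set s2 := √(((k:ℝ) * h - ((j + 1 : ℕ):ℝ) * l) ^ 2 + k * h ^ 2 + ((j + 1 : ℕ):ℝ) * l ^ 2)
      set s3 := √((((k + 1 : ℕ):ℝ) * h - ((j + 1 : ℕ):ℝ) * l) ^ 2 + ((k + 1 : ℕ):ℝ) * h ^ 2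
          + ((j + 1 : ℕ):ℝ) * l ^ 2)
      have hhl : 0 < h + l := by positivity
      refine le_of_mul_le_mul_left ?_ hhl
      calc (h + l) * ‖F^[k + 1] x - y (j + 1)‖ ≤
            h * ‖F^[k + 1] x - y j‖ + l * ‖F (F^[k] x) - F (y (j + 1))‖ := by rw [e2]; exact e3
        _ ≤ h * (P ^ (k + 1) * (C * s1)) + l * (P * (P ^ k * (C * s2))) := by
            gcongr
            exact e4.trans (by gcongr)
        _ = P ^ (k + 1) * C * (h * s1 + l * s2) := by ring
        _ ≤ P ^ (k + 1) * C * ((h + l) * s3) := by gcongr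
        _ = _ := by ring

theorem pow_exp_le {c s t : ℝ} (hc : 0 ≤ c) (hs : 0 ≤ s) (n : ℕ) (hn : n * s ≤ t) :
    (1 + c * s) ^ n ≤ Real.exp (c * t) := by
  have h1 : 1 + c * s ≤ Real.exp (c * s) := by linarith [Real.add_one_le_exp (c * s)]
  calc (1 + c * s) ^ n ≤ (Real.exp (c * s)) ^ n := by gcongr
    _ = Real.exp (c * (n * s)) := by rw [← Real.exp_nat_mul]; ring_nf
    _ ≤ _ := by gcongr

theorem iter_lip {F : X → X} {P : ℝ} (hP : 0 ≤ P) (hF : ∀ x y, ‖F x - F y‖ ≤ P * ‖x - y‖)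
    (x y : X) (n : ℕ) : ‖F^[n] x - F^[n] y‖ ≤ P ^ n * ‖x - y‖ := by
  induction n with
  | zero => simp
  | succ n ih =>
    rw [Function.iterate_succ_apply', Function.iterate_succ_apply']
    refine (hF _ _).trans ?_
    rw [pow_succ]
    have := mul_le_mul_of_nonneg_left ih hP
    linarith

theorem compare {F : X → X} {N L t : ℝ} (hN : 0 ≤ N) (hL : 0 ≤ L) (ht : 0 < t) {n m : ℕ}
    (hn : 0 < n) (hm : 0 < m) (hlN : t / m * N ≤ 1 / 2)
    (hF : ∀ x y, ‖F x - F y‖ ≤ (1 + N * (t / n)) * ‖x - y‖) {x : X} (hx : ‖F x - x‖ ≤ L * (t / n))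
    {y : ℕ → X} (y0 : y 0 = x)
    (hy : ∀ j, (t / n) • (y (j + 1) - y j) = (t / m) • (F (y (j + 1)) - y (j + 1))) :
    ‖F^[n] x - y m‖ ≤
      Real.exp (N * t) * (Real.exp (2 * N * t) * L * √(t * (t / n) + t * (t / m))) := by
  have hn' : (0:ℝ) < n := by exact_mod_cast hn
  have hm' : (0:ℝ) < m := by exact_mod_cast hm
  have hh : 0 < t / n := by positivity
  have hl : 0 < t / m := by positivity
  have hE : 1 ≤ Real.exp (2 * N * t) := Real.one_le_exp (by positivity)
  have hC : L ≤ Real.exp (2 * N * t) * L := by nlinarith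
  have h1 := kobayashi (C := Real.exp (2 * N * t) * L) hN hh hl (by positivity) hF
    (hx.trans (by gcongr)) y0 hy (m := m) (by
      intro j hj
      refine (implicit_near hN hh hl hlN hL hF hx y0 hy j).trans ?_
      have hjt : (j:ℝ) * (t / m) ≤ t := by
        have : (j:ℝ) ≤ m := by exact_mod_cast hj
        calc (j:ℝ) * (t / m) ≤ m * (t / m) := by gcongr
          _ = t := by field_simp
      have h2 := pow_exp_le (c := 2 * N) (by positivity) hl.le j hjt
      have h3 : 1 + 2 * (t / m * N) = 1 + 2 * N * (t / m) := by ring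
      rw [h3]
      calc (1 + 2 * N * (t / m)) ^ j * (j * (t / m) * L) ≤
          Real.exp (2 * N * t) * (j * (t / m) * L) := by gcongr
        _ = _ := by ring) n m le_rfl
  refine h1.trans ?_
  have e1 : (n:ℝ) * (t / n) = t := by field_simp
  have e2 : (m:ℝ) * (t / m) = t := by field_simp
  have e3 : ((n:ℝ) * (t / n) - m * (t / m)) ^ 2 + n * (t / n) ^ 2 + m * (t / m) ^ 2 =
      t * (t / n) + t * (t / m) := by
    rw [pow_two (t / (n:ℝ)), pow_two (t / (m:ℝ)), ← mul_assoc, ← mul_assoc, e1, e2]; ring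
  rw [e3]
  gcongr
  exact pow_exp_le hN hh.le n e1.le

theorem eventually_div_lt {t c : ℝ} (hc : 0 < c) : ∀ᶠ n : ℕ in atTop, t / (n:ℝ) < c :=
  (tendsto_const_div_atTop_nhds_zero_nat t).eventually (gt_mem_nhds hc)

theorem chernoff_core [CompleteSpace X] {ω : ℝ} {A B : Set (X × X)} {S T U : ℝ → X → X}
    (s : Setup ω A B S T) (hAB : IsMDissipativeSet (opShift (opSum A B) ω))
    (hU : GeneratedBy ω (opSum A B) U) {t : ℝ} (ht : 0 < t) {x a b : X} (ha : (x, a) ∈ A)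
    (hb : (x, b) ∈ B) {η : ℝ} (hη : 0 < η) :
    ∀ᶠ n : ℕ in atTop, ‖(fun y => S (t / n) (T (t / n) y))^[n] x - U t x‖ ≤ η := by
  have hW := abs_nonneg ω
  set N := 4 * |ω| with hN
  have hN0 : 0 ≤ N := by positivity
  set L := 4 * ‖b‖ + 2 * ‖a‖ with hL
  have hL0 : 0 ≤ L := by positivity
  have hr : ∀ n : ℕ, ∀ y : X, ∃ u, 0 < n → t * ω / n < 1 →
      ∃ z, (u, z) ∈ opSum A B ∧ u - (t / n) • z = y := by
    intro n y
    by_cases h : 0 < n ∧ t * ω / n < 1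
    · have hn' : (0:ℝ) < n := by exact_mod_cast h.1
      obtain ⟨u, c, h2, h3⟩ := range_of hAB (l := t / n) (by positivity)
        (by rw [div_mul_eq_mul_div]; exact h.2) y
      exact ⟨u, fun _ _ => ⟨c, h2, h3⟩⟩
    · exact ⟨y, fun h1 h2 => absurd ⟨h1, h2⟩ h⟩
  choose J hJ using hr
  have hlim := hU.2.2.2.2 t ht.le x J (fun n hn h y => hJ n y hn h)
  have hev1 : ∀ᶠ m : ℕ in atTop, ‖(J m)^[m] x - U t x‖ ≤ η / 3 := by
    have := (Metric.tendsto_nhds.1 hlim) (η / 3) (by positivity)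
    filter_upwards [this] with m hm
    rw [dist_eq_norm] at hm
    exact hm.le
  have hev2 : ∀ᶠ m : ℕ in atTop,
      Real.exp (N * t) * (Real.exp (2 * N * t) * L * √(t * (t / m) + t * (t / m))) < η / 3 := by
    have h0 := tendsto_const_div_atTop_nhds_zero_nat t
    have h1 : Tendsto (fun m : ℕ => Real.exp (N * t) *
        (Real.exp (2 * N * t) * L * √(t * (t / m) + t * (t / m)))) atTop
        (nhds (Real.exp (N * t) * (Real.exp (2 * N * t) * L * √(t * 0 + t * 0)))) :=
      (((h0.const_mul t).add (h0.const_mul t)).sqrt.const_mul _).const_mul _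
    simp only [mul_zero, add_zero, Real.sqrt_zero] at h1
    exact h1.eventually (gt_mem_nhds (by positivity))
  have hev3 : ∀ᶠ m : ℕ in atTop, t / (m:ℝ) < 1 / (2 * (N + 1)) :=
    eventually_div_lt (by positivity)
  obtain ⟨m, ⟨⟨m1, m2⟩, m3⟩, m4⟩ := (((hev1.and hev2).and hev3).and (eventually_gt_atTop 0)).exists
  have hm' : (0:ℝ) < m := by exact_mod_cast m4
  have hl : 0 < t / m := by positivity
  have hlN : t / m * N ≤ 1 / 2 := by
    rw [lt_div_iff₀ (by positivity)] at m3
    nlinarith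
  have hlω : t * ω / m < 1 := by
    have : t / m * ω ≤ t / m * |ω| := by gcongr; exact le_abs_self _
    rw [mul_div_right_comm]
    rw [hN] at hlN
    nlinarith
  obtain ⟨h0, h0p, H⟩ := iter_conv s hl hlN (u := fun j => (J m)^[j] x) (by
    intro j
    simp only [Function.iterate_succ_apply']
    exact hJ m _ m4 hlω) m (η / 3) (by positivity)
  filter_upwards [eventually_div_lt (t := t) h0p, eventually_ge_atTop m,
    eventually_div_lt (t := t) (c := 1 / (N + 1)) (by positivity)] with n n1 n2 n3
  have hn : 0 < n := by omega
  have hn' : (0:ℝ) < n := by exact_mod_cast hn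
  have hh : 0 < t / n := by positivity
  have hhω : 4 * |ω| * (t / n) ≤ 1 := by
    rw [lt_div_iff₀ (by positivity)] at n3
    nlinarith
  have hF := F_lip s hh hhω
  choose g hg using fun w => res_exists hN0 hh hl hlN hF w
  have hy : ∀ j, (t / n) • (g^[j + 1] x - g^[j] x) =
      (t / m) • (S (t / n) (T (t / n) (g^[j + 1] x)) - g^[j + 1] x) := by
    intro j
    rw [Function.iterate_succ_apply']
    exact hg _
  have e1 := H (t / n) hh n1 (fun j => g^[j] x) rfl hy
  have e2 := compare (F := fun y => S (t / n) (T (t / n) y)) hN0 hL0 ht hn m4 hlN hF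
    (F_near s hh hhω ha hb) (y := fun j => g^[j] x) rfl hy
  have e3 : Real.exp (N * t) * (Real.exp (2 * N * t) * L * √(t * (t / n) + t * (t / m))) ≤
      Real.exp (N * t) * (Real.exp (2 * N * t) * L * √(t * (t / m) + t * (t / m))) := by
    gcongr
  set z := (fun y => S (t / n) (T (t / n) y))^[n] x with hz
  have e4 : z - U t x = (z - g^[m] x) + (g^[m] x - (J m)^[m] x) + ((J m)^[m] x - U t x) := by abel
  rw [e4]
  refine (norm_add_le _ _).trans ?_
  have e5 := norm_add_le (z - g^[m] x) (g^[m] x - (J m)^[m] x)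
  linarith

end BP

/-- Brezis–Pazy/Kobayashi sequential product formula in Hilbert space: if `A`, `B` and
`A + B` are `ω`-m-dissipative, `A + B` is closed, and `S`, `T`, `U` are the semigroups
generated by `A`, `B`, `A + B`, then `U(t)x = lim (S(t/n) T(t/n))^n x`. -/
theorem brezis_pazy_sequential_splitting
    {X : Type*} [NormedAddCommGroup X] [InnerProductSpace ℝ X] [CompleteSpace X]
    (ω : ℝ) (A B : Set (X × X))
    (hA : IsMDissipativeSet (opShift A ω))
    (hB : IsMDissipativeSet (opShift B ω))
    (hAB : IsMDissipativeSet (opShift (opSum A B) ω))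
    (hclosed : IsClosed (opSum A B))
    (S T U : ℝ → X → X)
    (hS : GeneratedBy ω A S) (hT : GeneratedBy ω B T)
    (hU : GeneratedBy ω (opSum A B) U) :
    ∀ x : X, ∀ t, 0 ≤ t →
      Tendsto (fun n : ℕ => (fun y => S (t / n) (T (t / n) y))^[n] x) atTop
        (nhds (U t x)) := by
  intro x t ht
  rcases ht.eq_or_lt with rfl | ht
  · have h1 : ∀ n : ℕ, (fun y => S ((0:ℝ) / n) (T ((0:ℝ) / n) y))^[n] x = x := by
      intro n
      have h2 : (fun y => S ((0:ℝ) / n) (T ((0:ℝ) / n) y)) = id := by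
        funext y
        rw [zero_div, hT.1, hS.1, id]
      rw [h2, Function.iterate_id, id]
    simp only [h1, hU.1]
    exact tendsto_const_nhds
  · have hD : Dense {v : X | ∃ a b, (v, a) ∈ A ∧ (v, b) ∈ B} := by
      refine hAB.2.1.mono ?_
      rintro v ⟨y, q, ⟨a, b, ha, hb, -⟩, hq⟩
      have : v = q.1 := congrArg Prod.fst hq
      exact ⟨a, b, this ▸ ha, this ▸ hb⟩
    have s : BP.Setup ω A B S T := ⟨hA, hB, hS, hT, hD⟩
    have hW := abs_nonneg ω
    rw [Metric.tendsto_nhds]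
    intro ε hε
    set K := Real.exp (4 * |ω| * t) + Real.exp (ω * t) with hK
    have hK0 : 0 < K := by positivity
    obtain ⟨v, hv, a, b, ha, hb⟩ := Metric.dense_iff.1 hD x (ε / (2 * K)) (by positivity)
    rw [Metric.mem_ball, dist_comm, dist_eq_norm, lt_div_iff₀ (by positivity)] at hv
    filter_upwards [BP.chernoff_core s hAB hU ht ha hb (η := ε / 4) (by positivity),
      eventually_gt_atTop 0,
      BP.eventually_div_lt (t := t) (c := 1 / (4 * |ω| + 1)) (by positivity)] with n n1 n2 n3
    have hn' : (0:ℝ) < n := by exact_mod_cast n2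
    have hh : 0 < t / n := by positivity
    have hhω : 4 * |ω| * (t / n) ≤ 1 := by
      rw [lt_div_iff₀ (by positivity)] at n3
      nlinarith
    have e1 := BP.iter_lip (F := fun y => S (t / n) (T (t / n) y)) (by positivity)
      (BP.F_lip s hh hhω) x v n
    have e2 := BP.pow_exp_le (c := 4 * |ω|) (s := t / n) (t := t) (by positivity) hh.le n
      (by field_simp; exact le_rfl)
    have e3 := hU.2.2.1 t ht.le v x
    rw [norm_sub_rev v x] at e3
    have e4 := mul_le_mul_of_nonneg_right e2 (norm_nonneg (x - v))
    rw [dist_eq_norm]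
    set F := fun y => S (t / n) (T (t / n) y) with hF
    have e5 : F^[n] x - U t x = (F^[n] x - F^[n] v) + (F^[n] v - U t v) + (U t v - U t x) := by
      abel
    rw [e5]
    have e6 := norm_add_le ((F^[n] x - F^[n] v) + (F^[n] v - U t v)) (U t v - U t x)
    have e7 := norm_add_le (F^[n] x - F^[n] v) (F^[n] v - U t v)
    have e8 : Real.exp (4 * |ω| * t) * ‖x - v‖ + Real.exp (ω * t) * ‖x - v‖ < ε / 2 := by
      rw [hK] at hv
      linarith
    linarith
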